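/- arXiv:2309.03427 — 4 statements merged into one kernel-verified Lean document; each statement's English description precedes it below -/
import Mathlib

section
/- Let H be a separable infinite-dimensional complex Hilbert space and let U be a universal operator for H. Then the following are equivalent: (a) every bounded linear operator on H has a closed invariant subspace other than {0} and H; (b) every minimal closed U-invariant subspace of H is one-dimensional. -/
/-- A bounded operator `U` on a complex Hilbert space `H` is *universal* for `H` if for every
nonzero bounded operator `A` on `H` there exist a closed `U`-invariant subspace `M`, a nonzero
scalar `λ`, and a continuous linear equivalence `X : H ≃L[ℂ] M` such that
`U (X x) = λ • X (A x)` for all `x`. -/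
def IsUniversal {H : Type*} [NormedAddCommGroup H] [InnerProductSpace ℂ H]
    (U : H →L[ℂ] H) : Prop :=
  ∀ A : H →L[ℂ] H, A ≠ 0 →
    ∃ M : Submodule ℂ H, IsClosed (M : Set H) ∧ (∀ x ∈ M, U x ∈ M) ∧
      ∃ l : ℂ, l ≠ 0 ∧ ∃ X : H ≃L[ℂ] M, ∀ x : H, U ((X x : H)) = l • ((X (A x) : H))

/-- An orthonormal family in a separable inner product space is countable. -/
theorem Orthonormal.countable_of_separableSpace {ι E : Type*} [NormedAddCommGroup E]
    [InnerProductSpace ℂ E] [TopologicalSpace.SeparableSpace E] {v : ι → E}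
    (hv : Orthonormal ℂ v) : Countable ι := by
  refine Pairwise.countable_of_isOpen_disjoint (s := fun i => Metric.ball (v i) (1 / 2)) ?_
    (fun _ => Metric.isOpen_ball) (fun i => ⟨v i, Metric.mem_ball_self (by norm_num)⟩)
  intro i j hij
  refine Metric.ball_disjoint_ball ?_
  have h := norm_sub_sq (𝕜 := ℂ) (v i) (v j)
  rw [hv.1 i, hv.1 j, hv.2 hij] at h
  rw [dist_eq_norm]
  norm_num at h ⊢
  nlinarith [norm_nonneg (v i - v j)]

/-- An infinite-dimensional separable Hilbert space has a Hilbert basis indexed by `ℕ`. -/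
theorem nonempty_hilbertBasis_nat (E : Type*) [NormedAddCommGroup E]
    [InnerProductSpace ℂ E] [CompleteSpace E] [TopologicalSpace.SeparableSpace E]
    (hE : ¬ FiniteDimensional ℂ E) : Nonempty (HilbertBasis ℕ ℂ E) := by
  obtain ⟨w, b, -⟩ := exists_hilbertBasis ℂ E
  have : Countable w := b.orthonormal.countable_of_separableSpace
  have : Infinite w := by
    by_contra hfin
    have : Finite w := not_infinite_iff_finite.mp hfin
    have := Fintype.ofFinite w
    exact hE b.toOrthonormalBasis.toBasis.finiteDimensional_of_finite
  obtain ⟨e⟩ : Nonempty (ℕ ≃ w) := nonempty_equiv_of_countable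
  refine ⟨HilbertBasis.mk (v := b ∘ e) (b.orthonormal.comp e e.injective) ?_⟩
  rw [e.surjective.range_comp, b.dense_span]

/-- If every bounded operator on `H` has a nontrivial closed invariant subspace, then a minimal
closed invariant subspace of an operator on `H` is finite-dimensional. -/
theorem finiteDimensional_of_minimal_invariant {H : Type*} [NormedAddCommGroup H]
    [InnerProductSpace ℂ H] [CompleteSpace H] [TopologicalSpace.SeparableSpace H]
    (hH : ¬ FiniteDimensional ℂ H)
    (isp : ∀ A : H →L[ℂ] H, ∃ M : Submodule ℂ H,
      IsClosed (M : Set H) ∧ (∀ x ∈ M, A x ∈ M) ∧ M ≠ ⊥ ∧ M ≠ ⊤)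
    (U : H →L[ℂ] H) {M : Submodule ℂ H} (hM : IsClosed (M : Set H)) (hUM : ∀ x ∈ M, U x ∈ M)
    (hmin : ∀ N : Submodule ℂ H, IsClosed (N : Set H) → (∀ x ∈ N, U x ∈ N) → N ≤ M →
      N = ⊥ ∨ N = M) : FiniteDimensional ℂ M := by
  by_contra hMfin
  have : CompleteSpace M := hM.completeSpace_coe
  have : SecondCountableTopology H := UniformSpace.secondCountable_of_separable H
  obtain ⟨b⟩ := nonempty_hilbertBasis_nat H hH
  obtain ⟨c⟩ := nonempty_hilbertBasis_nat M hMfin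
  let e : H ≃L[ℂ] M := (b.repr.trans c.repr.symm).toContinuousLinearEquiv
  let f : H →L[ℂ] H := M.subtypeL ∘L (e : H →L[ℂ] M)
  let UM : M →L[ℂ] M := (U ∘L M.subtypeL).codRestrict M fun x => hUM x x.2
  have hf : Function.Injective f := Subtype.val_injective.comp e.injective
  have hfc : IsClosedMap f := hM.isClosedMap_subtype_val.comp e.toHomeomorph.isClosedMap
  have hf_top : Submodule.map (f : H →ₗ[ℂ] H) ⊤ = M := by
    ext x
    constructor
    · rintro ⟨y, -, rfl⟩
      exact (e y).2
    · intro hx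
      exact ⟨e.symm ⟨x, hx⟩, trivial, by simp [f]⟩
  obtain ⟨K, hK, hKinv, hKbot, hKtop⟩ := isp ((e.symm : M →L[ℂ] H) ∘L UM ∘L (e : H →L[ℂ] M))
  have hinv : ∀ x ∈ K.map (f : H →ₗ[ℂ] H), U x ∈ K.map (f : H →ₗ[ℂ] H) := by
    rintro _ ⟨y, hy, rfl⟩
    exact ⟨_, hKinv y hy, by simp [f, UM]; rfl⟩
  rcases hmin _ (hfc _ hK) hinv ((Submodule.map_mono le_top).trans_eq hf_top) with h | h
  · exact hKbot (Submodule.map_injective_of_injective hf (h.trans (Submodule.map_bot _).symm))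
  · exact hKtop (Submodule.map_injective_of_injective hf (h.trans hf_top.symm))

/-- A nonzero finite-dimensional minimal invariant subspace is one-dimensional. -/
theorem finrank_eq_one_of_minimal_invariant {H : Type*} [NormedAddCommGroup H]
    [InnerProductSpace ℂ H] (U : H →L[ℂ] H) {M : Submodule ℂ H} [FiniteDimensional ℂ M]
    (hUM : ∀ x ∈ M, U x ∈ M) (hM0 : M ≠ ⊥)
    (hmin : ∀ N : Submodule ℂ H, IsClosed (N : Set H) → (∀ x ∈ N, U x ∈ N) → N ≤ M →
      N = ⊥ ∨ N = M) : Module.finrank ℂ M = 1 := by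
  have : Nontrivial M := Submodule.nontrivial_iff_ne_bot.mpr hM0
  obtain ⟨μ, hμ⟩ := Module.End.exists_eigenvalue ((U : H →ₗ[ℂ] H).restrict hUM)
  obtain ⟨v, hv⟩ := hμ.exists_hasEigenvector
  have hUv : U v = μ • (v : H) := congrArg Subtype.val hv.apply_eq_smul
  have hv0 : (v : H) ≠ 0 := fun h => hv.2 (Subtype.ext h)
  have hinv : ∀ x ∈ Submodule.span ℂ {(v : H)}, U x ∈ Submodule.span ℂ {(v : H)} := by
    intro x hx
    obtain ⟨a, rfl⟩ := Submodule.mem_span_singleton.mp hx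
    rw [map_smul, hUv]
    exact Submodule.smul_mem _ _ (Submodule.smul_mem _ _ (Submodule.mem_span_singleton_self _))
  rcases hmin _ (Submodule.closed_of_finiteDimensional _) hinv
    ((Submodule.span_singleton_le_iff_mem _ _).mpr v.2) with h | h
  · exact absurd (Submodule.span_singleton_eq_bot.mp h) hv0
  · rw [← h]
    exact finrank_span_singleton hv0

/-- If `U` is universal for a separable infinite-dimensional complex Hilbert space `H`, then the
Invariant Subspace Problem for `H` is equivalent to the assertion that every minimal closed
`U`-invariant subspace of `H` is one-dimensional. -/
theorem isp_iff_minimal_invariant_one_dimensional {H : Type*} [NormedAddCommGroup H]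
    [InnerProductSpace ℂ H] [CompleteSpace H] [TopologicalSpace.SeparableSpace H]
    (hH : ¬ FiniteDimensional ℂ H)
    (U : H →L[ℂ] H) (hU : IsUniversal U) :
    (∀ A : H →L[ℂ] H, ∃ M : Submodule ℂ H,
        IsClosed (M : Set H) ∧ (∀ x ∈ M, A x ∈ M) ∧ M ≠ ⊥ ∧ M ≠ ⊤) ↔
    (∀ M : Submodule ℂ H, IsClosed (M : Set H) → (∀ x ∈ M, U x ∈ M) → M ≠ ⊥ →
        (∀ N : Submodule ℂ H, IsClosed (N : Set H) → (∀ x ∈ N, U x ∈ N) → N ≤ M →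
          N = ⊥ ∨ N = M) →
        Module.finrank ℂ M = 1) := by
  constructor
  · intro isp M hM hUM hM0 hmin
    have := finiteDimensional_of_minimal_invariant hH isp U hM hUM hmin
    exact finrank_eq_one_of_minimal_invariant U hUM hM0 hmin
  · intro hmin A
    rcases eq_or_ne A 0 with rfl | hA
    · have : Nontrivial H := by
        by_contra h
        have := not_nontrivial_iff_subsingleton.mp h
        exact hH inferInstance
      obtain ⟨v, hv⟩ := exists_ne (0 : H)
      refine ⟨Submodule.span ℂ {v}, Submodule.closed_of_finiteDimensional _,
        fun x _ => Submodule.zero_mem _, fun h => hv (Submodule.span_singleton_eq_bot.mp h), ?_⟩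
      intro h
      exact hH ⟨h ▸ Submodule.fg_span_singleton v⟩
    · obtain ⟨M, hM, hUM, l, hl, X, hX⟩ := hU A hA
      have hMfin : ¬ FiniteDimensional ℂ M := fun _ =>
        hH (Module.Finite.equiv X.symm.toLinearEquiv)
      have hM0 : M ≠ ⊥ := by
        rintro rfl
        exact hMfin inferInstance
      obtain ⟨N, hN, hUN, hNM, hN0, hN1⟩ : ∃ N : Submodule ℂ H, IsClosed (N : Set H) ∧
          (∀ x ∈ N, U x ∈ N) ∧ N ≤ M ∧ N ≠ ⊥ ∧ N ≠ M := by
        by_contra! h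
        have h1 := hmin M hM hUM hM0 fun N hN hUN hNM =>
          or_iff_not_imp_left.mpr (h N hN hUN hNM)
        exact hMfin (Module.finite_of_finrank_eq_succ h1)
      let f : H →L[ℂ] H := M.subtypeL ∘L (X : H →L[ℂ] M)
      refine ⟨N.comap (f : H →ₗ[ℂ] H), hN.preimage f.continuous, ?_, ?_, ?_⟩
      · intro x hx
        have h : l • (X (A x) : H) ∈ N := hX x ▸ hUN _ hx
        exact (N.smul_mem_iff hl).mp h
      · intro h
        obtain ⟨y, hy, hy0⟩ := N.ne_bot_iff.mp hN0
        have hmem : X.symm ⟨y, hNM hy⟩ ∈ N.comap (f : H →ₗ[ℂ] H) := by simpa [f] using hy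
        rw [h, Submodule.mem_bot, map_eq_zero_iff _ X.symm.injective] at hmem
        exact hy0 (congrArg Subtype.val hmem)
      · intro h
        refine hN1 (le_antisymm hNM fun y hy => ?_)
        have hmem : X.symm ⟨y, hy⟩ ∈ N.comap (f : H →ₗ[ℂ] H) := h ▸ Submodule.mem_top
        simpa [f] using hmem
end

section
/- Let K be a complex Hilbert space, t : K →L[ℂ] K a bounded linear operator, and T the diagonal extension of t on ℓ²(ℕ, K). Let M be a closed subspace of ℓ²(ℕ, K) with T(M) ⊆ M which contains two linearly independent elements. If there exists n ∈ ℕ such that the coordinate image {f n : f ∈ M} ⊆ K is nonzero and finite-dimensional, then T restricted to M has a nontrivial invariant subspace: there exists a closed subspace N of ℓ²(ℕ, K) with N ⊆ M, T(N) ⊆ N, N ≠ {0}, and N ≠ M. -/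
/-- A continuous operator leaving invariant a finite-dimensional subspace of dimension at least two
of a complex normed space has a nontrivial closed invariant subspace inside it. -/
theorem exists_invariant_submodule_of_finiteDimensional {E : Type*} [NormedAddCommGroup E]
    [NormedSpace ℂ E] (T : E →L[ℂ] E) (M : Submodule ℂ E) [FiniteDimensional ℂ M]
    (hMinv : ∀ f ∈ M, T f ∈ M)
    (hMind : ∃ f g : E, f ∈ M ∧ g ∈ M ∧ LinearIndependent ℂ ![f, g]) :
    ∃ N : Submodule ℂ E, IsClosed (N : Set E) ∧ N ≤ M ∧ (∀ f ∈ N, T f ∈ N) ∧ N ≠ ⊥ ∧ N ≠ M := by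
  obtain ⟨f, g, hf, hg, hfg⟩ := hMind
  have hf0 : f ≠ 0 := hfg.ne_zero 0
  have : Nontrivial M := ⟨⟨f, hf⟩, 0, fun h => hf0 (congrArg Subtype.val h)⟩
  obtain ⟨c, hc⟩ := Module.End.exists_eigenvalue (T.toLinearMap.restrict hMinv)
  obtain ⟨⟨v, hv⟩, hvc⟩ := hc.exists_hasEigenvector
  have hTv : T v = c • v := congrArg Subtype.val hvc.apply_eq_smul
  have hv0 : v ≠ 0 := fun h => hvc.2 (Subtype.ext h)
  refine ⟨ℂ ∙ v, Submodule.closed_of_finiteDimensional _, ?_, ?_, ?_, ?_⟩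
  · rwa [Submodule.span_singleton_le_iff_mem]
  · intro x hx
    obtain ⟨a, rfl⟩ := Submodule.mem_span_singleton.1 hx
    rw [map_smul, hTv]
    exact Submodule.smul_mem _ _ (Submodule.smul_mem _ _ (Submodule.mem_span_singleton_self v))
  · rwa [Ne, Submodule.span_singleton_eq_bot]
  · rintro rfl
    obtain ⟨a, rfl⟩ := Submodule.mem_span_singleton.1 hf
    obtain ⟨b, rfl⟩ := Submodule.mem_span_singleton.1 hg
    have h := LinearIndependent.pair_iff.1 hfg b (-a) (by
      rw [smul_smul, smul_smul, ← add_smul]; ring_nf; simp)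
    exact hf0 (by simp [neg_eq_zero.1 h.2])

/-- If a continuous linear map `P` intertwines `T` with `t` and has nonzero finite-dimensional
image on a closed `T`-invariant subspace `M` of dimension at least two, then `T` restricted to `M`
has a nontrivial closed invariant subspace. -/
theorem exists_invariant_submodule_of_finiteDimensional_map {E F : Type*} [NormedAddCommGroup E]
    [NormedSpace ℂ E] [NormedAddCommGroup F] [NormedSpace ℂ F] (T : E →L[ℂ] E) (t : F →L[ℂ] F)
    (P : E →L[ℂ] F) (hP : ∀ f, P (T f) = t (P f)) (M : Submodule ℂ E)
    (hMc : IsClosed (M : Set E)) (hMinv : ∀ f ∈ M, T f ∈ M)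
    (hMind : ∃ f g : E, f ∈ M ∧ g ∈ M ∧ LinearIndependent ℂ ![f, g])
    (hne : M.map P.toLinearMap ≠ ⊥) (hfin : FiniteDimensional ℂ (M.map P.toLinearMap)) :
    ∃ N : Submodule ℂ E, IsClosed (N : Set E) ∧ N ≤ M ∧ (∀ f ∈ N, T f ∈ N) ∧ N ≠ ⊥ ∧ N ≠ M := by
  by_cases hbot : M ⊓ P.toLinearMap.ker = ⊥
  · have hinj : Function.Injective (P.toLinearMap.submoduleMap M) := by
      rw [injective_iff_map_eq_zero]
      rintro ⟨x, hx⟩ h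
      have hmem : x ∈ M ⊓ P.toLinearMap.ker := ⟨hx, congrArg Subtype.val h⟩
      rw [hbot, Submodule.mem_bot] at hmem
      exact Subtype.ext hmem
    have : FiniteDimensional ℂ M := FiniteDimensional.of_injective _ hinj
    exact exists_invariant_submodule_of_finiteDimensional T M hMinv hMind
  · refine ⟨M ⊓ P.toLinearMap.ker, hMc.inter P.isClosed_ker, inf_le_left, ?_, hbot, ?_⟩
    · rintro f ⟨hf, hPf⟩
      refine ⟨hMinv f hf, ?_⟩
      have hPf' : P f = 0 := hPf
      change P (T f) = 0
      rw [hP, hPf', map_zero]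
    · intro h
      exact hne (LinearMap.le_ker_iff_map.1 (inf_eq_left.1 h))

/-- Let `T` be the diagonal extension of a bounded operator `t` on a complex Hilbert space `K`
to `ℓ²(ℕ, K)`, and let `M` be a closed `T`-invariant subspace containing two linearly
independent elements.  If for some `n` the coordinate image `{f n : f ∈ M}` is nonzero and
finite-dimensional, then `T` restricted to `M` has a nontrivial invariant subspace. -/
theorem restriction_has_invariant_subspace_of_finiteDimensional_coordinate_image
    (K : Type*) [NormedAddCommGroup K] [InnerProductSpace ℂ K] [CompleteSpace K]
    (t : K →L[ℂ] K)
    (T : lp (fun _ : ℕ => K) 2 →L[ℂ] lp (fun _ : ℕ => K) 2)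
    (hT : ∀ (f : lp (fun _ : ℕ => K) 2) (n : ℕ),
      (T f : ∀ _ : ℕ, K) n = t ((f : ∀ _ : ℕ, K) n))
    (M : Submodule ℂ (lp (fun _ : ℕ => K) 2))
    (hMc : IsClosed (M : Set (lp (fun _ : ℕ => K) 2)))
    (hMinv : ∀ f ∈ M, T f ∈ M)
    (hMind : ∃ f g : lp (fun _ : ℕ => K) 2, f ∈ M ∧ g ∈ M ∧ LinearIndependent ℂ ![f, g])
    (hfin : ∃ (n : ℕ) (V : Submodule ℂ K),
      (V : Set K) = {x : K | ∃ f ∈ M, (f : ∀ _ : ℕ, K) n = x} ∧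
      V ≠ ⊥ ∧ FiniteDimensional ℂ V) :
    ∃ N : Submodule ℂ (lp (fun _ : ℕ => K) 2),
      IsClosed (N : Set (lp (fun _ : ℕ => K) 2)) ∧ N ≤ M ∧ (∀ f ∈ N, T f ∈ N) ∧
      N ≠ ⊥ ∧ N ≠ M := by
  obtain ⟨n, V, hV, hV0, hVfin⟩ := hfin
  have hmap : M.map (lp.evalCLM ℂ (fun _ : ℕ => K) 2 n).toLinearMap = V :=
    SetLike.coe_injective (by rw [hV]; rfl)
  exact exists_invariant_submodule_of_finiteDimensional_map T t
    (lp.evalCLM ℂ (fun _ : ℕ => K) 2 n) (fun f => hT f n) M hMc hMinv hMind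
    (hmap ▸ hV0) (hmap ▸ hVfin)
end

section
/- Let K be a complex Hilbert space, t : K →L[ℂ] K a bounded linear operator, and T the diagonal extension of t on ℓ²(ℕ, K). Let M be a closed subspace of ℓ²(ℕ, K) with T(M) ⊆ M. Assume: (i) there exists n ∈ ℕ such that the coordinate image V := {f n : f ∈ M} ⊆ K is closed in K and infinite-dimensional; and (ii) for every infinite-dimensional closed subspace W of K with t(W) ⊆ W there exists a closed subspace W₀ with t(W₀) ⊆ W₀, W₀ ⊆ W, W₀ ≠ {0}, and W₀ ≠ W. Then there exists a closed subspace N of ℓ²(ℕ, K) with N ⊆ M, T(N) ⊆ N, N ≠ {0}, and N ≠ M. -/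
/-- Let `T` be the diagonal extension of a bounded operator `t` on a complex Hilbert space `K`
to `ℓ²(ℕ, K)`, and let `M` be a closed `T`-invariant subspace.  Assume (i) for some `n` the
coordinate image `{f n : f ∈ M}` is closed and infinite-dimensional, and (ii) every
infinite-dimensional closed `t`-invariant subspace of `K` contains a nontrivial proper closed
`t`-invariant subspace.  Then `T` restricted to `M` has a nontrivial invariant subspace. -/
theorem restriction_has_invariant_subspace_of_closed_coordinate_image
    (K : Type*) [NormedAddCommGroup K] [InnerProductSpace ℂ K] [CompleteSpace K]
    (t : K →L[ℂ] K)
    (T : lp (fun _ : ℕ => K) 2 →L[ℂ] lp (fun _ : ℕ => K) 2)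
    (hT : ∀ (f : lp (fun _ : ℕ => K) 2) (n : ℕ),
      (T f : ∀ _ : ℕ, K) n = t ((f : ∀ _ : ℕ, K) n))
    (M : Submodule ℂ (lp (fun _ : ℕ => K) 2))
    (hMc : IsClosed (M : Set (lp (fun _ : ℕ => K) 2)))
    (hMinv : ∀ f ∈ M, T f ∈ M)
    (hcoord : ∃ (n : ℕ) (V : Submodule ℂ K),
      (V : Set K) = {x : K | ∃ f ∈ M, (f : ∀ _ : ℕ, K) n = x} ∧
      IsClosed (V : Set K) ∧ ¬ FiniteDimensional ℂ V)
    (ht : ∀ W : Submodule ℂ K, IsClosed (W : Set K) → ¬ FiniteDimensional ℂ W →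
      (∀ x ∈ W, t x ∈ W) →
      ∃ W₀ : Submodule ℂ K, IsClosed (W₀ : Set K) ∧ (∀ x ∈ W₀, t x ∈ W₀) ∧
        W₀ ≤ W ∧ W₀ ≠ ⊥ ∧ W₀ ≠ W) :
    ∃ N : Submodule ℂ (lp (fun _ : ℕ => K) 2),
      IsClosed (N : Set (lp (fun _ : ℕ => K) 2)) ∧ N ≤ M ∧ (∀ f ∈ N, T f ∈ N) ∧
      N ≠ ⊥ ∧ N ≠ M := by
  obtain ⟨n, V, hV, hVc, hVinf⟩ := hcoord
  have mem_V (x : K) : x ∈ V ↔ ∃ f ∈ M, (f : ∀ _ : ℕ, K) n = x := Set.ext_iff.mp hV x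
  have hVinv : ∀ x ∈ V, t x ∈ V := by
    intro x hx
    obtain ⟨f, hf, rfl⟩ := (mem_V x).1 hx
    exact (mem_V _).2 ⟨T f, hMinv f hf, hT f n⟩
  obtain ⟨W₀, hWc, hWinv, hWV, hWbot, hWne⟩ := ht V hVc hVinf hVinv
  let e := lp.evalCLM ℂ (fun _ : ℕ => K) 2 n
  refine ⟨M ⊓ W₀.comap e.toLinearMap, hMc.inter (hWc.preimage e.continuous), inf_le_left,
    ?_, ?_, ?_⟩
  · rintro f ⟨hfM, hfW⟩
    refine ⟨hMinv f hfM, ?_⟩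
    change (T f : ∀ _ : ℕ, K) n ∈ W₀
    rw [hT]
    exact hWinv _ hfW
  · obtain ⟨w, hw, hw0⟩ := W₀.exists_mem_ne_zero_of_ne_bot hWbot
    obtain ⟨f, hf, rfl⟩ := (mem_V w).1 (hWV hw)
    refine (Submodule.ne_bot_iff _).2 ⟨f, ⟨hf, hw⟩, ?_⟩
    rintro rfl
    exact hw0 rfl
  · intro hNM
    refine hWne (le_antisymm hWV fun x hx => ?_)
    obtain ⟨f, hf, rfl⟩ := (mem_V x).1 hx
    exact (inf_eq_left.1 hNM) hf
end

section
/- Let K be a complex Hilbert space, s : K →L[ℂ] K an isometry, t := s* its adjoint, and T the diagonal extension of t on ℓ²(ℕ, K). For g ∈ K let V(g) denote the closure of the span of the orbit {tⁱ g : i ∈ ℕ}, and let J(g) := { ∑ᵢ βᵢ • tⁱ g : β : ℕ → ℂ with ∑ᵢ |βᵢ| < ∞ }. Assume that for every nonzero g ∈ K there exists a closed subspace U of K with t(U) ⊆ U, U ⊆ V(g), U ≠ V(g), and U ∩ J(g) ≠ {0}. Then no closed T-invariant subspace of ℓ²(ℕ, K) is minimal: for every closed subspace M with T(M) ⊆ M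 and M ≠ {0}, there exists a closed subspace N with T(N) ⊆ N, N ⊆ M, N ≠ {0}, and N ≠ M. -/
/-- Let `s` be an isometry on a complex Hilbert space `K`, `t := s*` its adjoint, and `T` the
diagonal extension of `t` to `ℓ²(ℕ, K)`.  For `g ∈ K` let `V g` be the closed span of the
orbit `{tⁱ g : i ∈ ℕ}` and `J g` the set of sums `∑ᵢ βᵢ • tⁱ g` over absolutely summable
`β : ℕ → ℂ`.  If for every nonzero `g` there is a closed `t`-invariant subspace `U ⊆ V g` with
`U ≠ V g` and `U ∩ J g ≠ {0}`, then no closed `T`-invariant subspace of `ℓ²(ℕ, K)` is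
minimal. -/
theorem no_minimal_invariant_subspace (K : Type*) [NormedAddCommGroup K]
    [InnerProductSpace ℂ K] [CompleteSpace K]
    (s : K →L[ℂ] K) (hs : Isometry s)
    (t : K →L[ℂ] K) (hts : t = ContinuousLinearMap.adjoint s)
    (T : lp (fun _ : ℕ => K) 2 →L[ℂ] lp (fun _ : ℕ => K) 2)
    (hT : ∀ (f : lp (fun _ : ℕ => K) 2) (n : ℕ),
      (T f : ∀ _ : ℕ, K) n = t ((f : ∀ _ : ℕ, K) n))
    (V : K → Submodule ℂ K)
    (hV : ∀ g : K,
      V g = (Submodule.span ℂ (Set.range fun i : ℕ => (t ^ i) g)).topologicalClosure)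
    (J : K → Set K)
    (hJ : ∀ g : K, J g =
      {x : K | ∃ β : ℕ → ℂ, (Summable fun i => ‖β i‖) ∧ x = ∑' i : ℕ, β i • (t ^ i) g})
    (hyp : ∀ g : K, g ≠ 0 →
      ∃ U : Submodule ℂ K, IsClosed (U : Set K) ∧ (∀ x ∈ U, t x ∈ U) ∧
        U ≤ V g ∧ U ≠ V g ∧ ∃ x ∈ U, x ∈ J g ∧ x ≠ 0) :
    ∀ M : Submodule ℂ (lp (fun _ : ℕ => K) 2),
      IsClosed (M : Set (lp (fun _ : ℕ => K) 2)) → (∀ f ∈ M, T f ∈ M) → M ≠ ⊥ →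
      ∃ N : Submodule ℂ (lp (fun _ : ℕ => K) 2),
        IsClosed (N : Set (lp (fun _ : ℕ => K) 2)) ∧ (∀ f ∈ N, T f ∈ N) ∧
        N ≤ M ∧ N ≠ ⊥ ∧ N ≠ M := by
  intro M hMc hMT hM
  obtain ⟨f, hfM, hf⟩ := M.ne_bot_iff.mp hM
  obtain ⟨n, hn⟩ : ∃ n, f n ≠ 0 := by
    by_contra! h
    exact hf (lp.ext (funext h))
  obtain ⟨U, hUc, hUt, hUle, hUV, x, hxU, hxJ, hx⟩ := hyp (f n) hn
  rw [hJ] at hxJ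
  obtain ⟨β, hβ, rfl⟩ := hxJ
  have ht : ‖t‖ ≤ 1 := by
    rw [hts, LinearIsometryEquiv.norm_map]
    exact s.opNorm_le_bound zero_le_one fun y => by
      rw [one_mul, hs.norm_map_of_map_zero (map_zero s)]
  have hTnorm : ∀ k, ‖T k‖ ≤ ‖k‖ := fun k =>
    lp.norm_mono two_ne_zero fun m => by
      rw [hT]
      exact t.le_of_opNorm_le_of_le ht le_rfl |>.trans_eq (one_mul _)
  have hpow_norm : ∀ i : ℕ, ‖(T ^ i) f‖ ≤ ‖f‖ := fun i => by
    induction i with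
    | zero => simp
    | succ i ih =>
      rw [pow_succ']
      exact (hTnorm _).trans ih
  have hpow_apply : ∀ i : ℕ, ((T ^ i) f) n = (t ^ i) (f n) := fun i => by
    induction i with
    | zero => simp
    | succ i ih =>
      rw [pow_succ', pow_succ', mul_apply_eq_comp, hT, ih, mul_apply_eq_comp]
  have hpow_mem : ∀ i : ℕ, (T ^ i) f ∈ M := fun i => by
    induction i with
    | zero => simpa
    | succ i ih =>
      rw [pow_succ']
      exact hMT _ ih
  have hsum : Summable fun i => β i • (T ^ i) f := by
    refine Summable.of_norm_bounded (hβ.mul_right ‖f‖) fun i => ?_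
    rw [norm_smul]
    gcongr
    exact hpow_norm i
  let e := lp.evalCLM ℂ (fun _ : ℕ => K) 2 n
  have he : ∀ k, e k = k n := fun _ => rfl
  have hsum_apply : e (∑' i, β i • (T ^ i) f) = ∑' i, β i • (t ^ i) (f n) := by
    rw [e.map_tsum hsum]
    exact tsum_congr fun i => by rw [map_smul, he, hpow_apply]
  refine ⟨M ⊓ U.comap e.toLinearMap, hMc.inter (hUc.preimage e.continuous),
    fun k hk => ⟨hMT k hk.1, ?_⟩, inf_le_left, ?_, fun h => ?_⟩
  · change e (T k) ∈ U
    rw [he, hT]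
    exact hUt _ hk.2
  · refine (Submodule.ne_bot_iff _).mpr ⟨∑' i, β i • (T ^ i) f, ⟨?_, ?_⟩, fun h => hx ?_⟩
    · exact hMc.mem_of_tendsto hsum.hasSum
        (Filter.Eventually.of_forall fun S =>
          M.sum_mem fun i _ => M.smul_mem _ (hpow_mem i))
    · change e _ ∈ U
      rwa [hsum_apply]
    · rw [← hsum_apply, h, map_zero]
  · have hfU : f n ∈ U := (h.ge hfM).2
    refine hUV (le_antisymm hUle ?_)
    rw [hV]
    refine Submodule.topologicalClosure_minimal _ (Submodule.span_le.mpr ?_) hUc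
    rintro _ ⟨i, rfl⟩
    induction i with
    | zero => simpa
    | succ i ih =>
      simp only [pow_succ']
      exact hUt _ ih
end
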